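/- arXiv:1205.4691 — 3 statements merged into one kernel-verified Lean document; each statement's English description precedes it below -/
import Mathlib

section
/- Naturality of digging: for any types A, B, any relation f : A → B → Prop, any m : Multiset A and any N : Multiset (Multiset B), Multiset.Rel f m N.join holds if and only if there exists M : Multiset (Multiset A) with m = M.join and Multiset.Rel (Multiset.Rel f) M N. Equivalently, the composite of !f followed by the digging p_B equals the composite of the digging p_A followed by !!f. -/
/-- Naturality of digging: `p_B ∘ !f = !!f ∘ p_A` as relations from `Multiset A`
to `Multiset (Multiset B)`. -/
theorem digging_natural {A B : Type*} (f : A → B → Prop) (m : Multiset A)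
    (N : Multiset (Multiset B)) :
    Multiset.Rel f m N.join ↔
      ∃ M : Multiset (Multiset A), m = M.join ∧ Multiset.Rel (Multiset.Rel f) M N := by
  constructor
  · intro h
    induction N using Multiset.induction_on generalizing m with
    | empty =>
      rw [Multiset.join_zero, Multiset.rel_zero_right] at h
      exact ⟨0, by simp [h], Multiset.Rel.zero⟩
    | cons b N ih =>
      rw [Multiset.join_cons, Multiset.rel_add_right] at h
      obtain ⟨m₀, m₁, h₀, h₁, rfl⟩ := h
      obtain ⟨M, rfl, hM⟩ := ih m₁ h₁
      exact ⟨m₀ ::ₘ M, by simp, Multiset.Rel.cons h₀ hM⟩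
  · rintro ⟨M, rfl, hM⟩
    exact Multiset.rel_join hM
end

section
/- Coassociativity of digging: for any type A, any m : Multiset A and any MM : Multiset (Multiset (Multiset A)), m = MM.join.join if and only if there exists M : Multiset (Multiset A) with m = M.join and Multiset.Rel (fun (x : Multiset A) (X : Multiset (Multiset A)) => x = X.join) M MM. That is, the composites p_{!A} ∘ p_A and !p_A ∘ p_A are equal as relations from Multiset A to Multiset (Multiset (Multiset A)). -/
/-- Coassociativity of digging: `p_{!A} ∘ p_A = !p_A ∘ p_A` as relations from
`Multiset A` to `Multiset (Multiset (Multiset A))`. -/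
theorem digging_coassoc {A : Type*} (m : Multiset A) (MM : Multiset (Multiset (Multiset A))) :
    m = MM.join.join ↔
      ∃ M : Multiset (Multiset A), m = M.join ∧
        Multiset.Rel (fun (x : Multiset A) (X : Multiset (Multiset A)) => x = X.join) M MM := by
  have key : (MM.map Multiset.join).join = MM.join.join := by
    induction MM using Multiset.induction with
    | empty => simp
    | cons a s ih => simp [ih]
  constructor
  · intro h
    exact ⟨MM.map Multiset.join, h.trans key.symm,
      Multiset.rel_map_left.mpr (Multiset.rel_refl_of_refl_on fun _ _ => rfl)⟩
  · rintro ⟨M, rfl, h⟩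
    have h2 : M = MM.map Multiset.join :=
      Multiset.rel_eq.mp (Multiset.rel_map_right.mpr h)
    rw [h2, key]
end

section
/- Bialgebra compatibility of contraction and cocontraction (Riesz decomposition for multisets): for any type A and all multisets l, r, x, y : Multiset A, l + r = x + y if and only if there exist multisets p, q, s, t : Multiset A with l = p + q, r = s + t, x = p + s and y = q + t. Equivalently, in Rel the composite c_A ∘ c̄_A equals (c̄_A ⊗ c̄_A) ∘ (id ⊗ swap ⊗ id) ∘ (c_A ⊗ c_A). -/
/-- Bialgebra compatibility of contraction and cocontraction (Riesz decomposition
for multisets). -/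
theorem contraction_cocontraction_bialgebra {A : Type*} (l r x y : Multiset A) :
    l + r = x + y ↔
      ∃ p q s t : Multiset A, l = p + q ∧ r = s + t ∧ x = p + s ∧ y = q + t := by
  classical
  constructor
  · intro h
    have hc : ∀ a, l.count a + r.count a = x.count a + y.count a := by
      intro a
      rw [← Multiset.count_add, h, Multiset.count_add]
    refine ⟨l ∩ x, l - x, x - l, r - (x - l), ?_, ?_, ?_, ?_⟩ <;>
    · ext a
      have := hc a
      simp only [Multiset.count_add, Multiset.count_inter, Multiset.count_sub]
      omega
  · rintro ⟨p, q, s, t, rfl, rfl, rfl, rfl⟩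
    exact add_add_add_comm p q s t
end
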